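/- (Combinatorial content of Table 1 and of the in-control transcript distribution.) For each permutation ρ ∈ S₄, consider the 4-tuple of pairwise distinct values x = (ρ(1), ρ(2), ρ(3), ρ(4)) and its transcript T(x) = OP(x₂,x₃,x₄) ∘' OP(x₁,x₂,x₃), where ∘' denotes forming the transcript π⁻¹∘π' of the two consecutive ordinal patterns. Then, as ρ ranges over all 24 elements of S₄, the number of ρ with T(x) = π⁽ᵏ⁾ equals, for k = 1, 2, 3, 4, 5, 6 respectively: 2, 2, 2, 7, 7, 4. -/

import Mathlib

/-- The six elements of `S₃` in lexicographic one-line order (0-indexed). -/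
def p1 : Equiv.Perm (Fin 3) := 1                               -- (1,2,3)
def p2 : Equiv.Perm (Fin 3) := Equiv.swap 1 2                  -- (1,3,2)
def p3 : Equiv.Perm (Fin 3) := Equiv.swap 0 1                  -- (2,1,3)
def p4 : Equiv.Perm (Fin 3) := Equiv.swap 0 1 * Equiv.swap 1 2 -- (2,3,1)
def p5 : Equiv.Perm (Fin 3) := Equiv.swap 1 2 * Equiv.swap 0 1 -- (3,1,2)
def p6 : Equiv.Perm (Fin 3) := Equiv.swap 0 2                  -- (3,2,1)

/-- The transcript of the two consecutive length-3 ordinal patterns of the 4-tuple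
`(ρ(1), ρ(2), ρ(3), ρ(4))` of pairwise distinct values, where `ρ ∈ S₄`: it equals
`OP(x₁,x₂,x₃)⁻¹ ∘ OP(x₂,x₃,x₄)`, the ordinal pattern `OP` being the sorting
permutation of the corresponding window. -/
noncomputable def T4 (ρ : Equiv.Perm (Fin 4)) : Equiv.Perm (Fin 3) :=
  (Tuple.sort fun k : Fin 3 => ρ k.castSucc)⁻¹ * (Tuple.sort fun k : Fin 3 => ρ k.succ)

theorem sort_eq_iff_lt {α : Type*} [LinearOrder α] {f : Fin 3 → α} (hf : Function.Injective f)
    (σ : Equiv.Perm (Fin 3)) :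
    Tuple.sort f = σ ↔ f (σ 0) < f (σ 1) ∧ f (σ 1) < f (σ 2) := by
  constructor
  · rintro rfl
    have h : StrictMono (f ∘ Tuple.sort f) :=
      (Tuple.monotone_sort f).strictMono_of_injective (hf.comp (Tuple.sort f).injective)
    exact ⟨h (by decide : (0 : Fin 3) < 1), h (by decide : (1 : Fin 3) < 2)⟩
  · rintro ⟨h₀, h₁⟩
    have h : StrictMono (f ∘ σ) := by
      rw [Fin.strictMono_iff_lt_succ]
      intro i
      fin_cases i
      · exact h₀
      · exact h₁
    exact (Tuple.eq_sort_iff.2 ⟨h.monotone, fun i j hij he => absurd he (h hij).ne⟩).symm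

theorem T4_eq_iff (ρ : Equiv.Perm (Fin 4)) (p : Equiv.Perm (Fin 3)) :
    T4 ρ = p ↔ ∃ σ : Equiv.Perm (Fin 3),
      (ρ (σ 0).castSucc < ρ (σ 1).castSucc ∧ ρ (σ 1).castSucc < ρ (σ 2).castSucc) ∧
      (ρ (σ (p 0)).succ < ρ (σ (p 1)).succ ∧ ρ (σ (p 1)).succ < ρ (σ (p 2)).succ) := by
  have hf := sort_eq_iff_lt (ρ.injective.comp (Fin.castSucc_injective 3))
  have hg := sort_eq_iff_lt (ρ.injective.comp (Fin.succ_injective 3))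
  rw [T4, inv_mul_eq_iff_eq_mul]
  constructor
  · intro h
    exact ⟨_, (hf _).1 rfl, (hg _).1 h⟩
  · rintro ⟨σ, h₁, h₂⟩
    exact ((hg (σ * p)).2 h₂).trans (congrArg (· * p) ((hf σ).2 h₁).symm)

/-- Combinatorial content of Table 1: among the 24 permutations `ρ ∈ S₄`, the number of
those whose associated transcript equals `π⁽¹⁾, …, π⁽⁶⁾` is `2, 2, 2, 7, 7, 4`,
respectively. -/
theorem transcript_counts_over_S4 :
    (Finset.univ.filter fun ρ : Equiv.Perm (Fin 4) => T4 ρ = p1).card = 2 ∧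
    (Finset.univ.filter fun ρ : Equiv.Perm (Fin 4) => T4 ρ = p2).card = 2 ∧
    (Finset.univ.filter fun ρ : Equiv.Perm (Fin 4) => T4 ρ = p3).card = 2 ∧
    (Finset.univ.filter fun ρ : Equiv.Perm (Fin 4) => T4 ρ = p4).card = 7 ∧
    (Finset.univ.filter fun ρ : Equiv.Perm (Fin 4) => T4 ρ = p5).card = 7 ∧
    (Finset.univ.filter fun ρ : Equiv.Perm (Fin 4) => T4 ρ = p6).card = 4 := by
  simp only [T4_eq_iff]
  decide +kernel
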